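/- Let F be the formal power series over ℤ whose n-th coefficient is 2^{e₀(n)}, and let F₂ be the formal power series whose n-th coefficient is 2^{e₀(n/2)} if n is even and 0 if n is odd (so F₂ represents F(X²)). Then (X + 2)·F₂ = 1 + F. -/

import Mathlib

/-- The number of zeros in the binary representation of `n` (with `e₀ 0 = 0`). -/
def binaryZeros (n : ℕ) : ℕ := (Nat.digits 2 n).count 0

theorem binaryZeros_two_mul {n : ℕ} (hn : n ≠ 0) :
    binaryZeros (2 * n) = binaryZeros n + 1 := by
  unfold binaryZeros
  rw [Nat.digits_def' one_lt_two (by omega)]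
  simp

theorem binaryZeros_two_mul_add_one (n : ℕ) :
    binaryZeros (2 * n + 1) = binaryZeros n := by
  unfold binaryZeros
  rw [Nat.digits_def' one_lt_two (by omega), show (2 * n + 1) % 2 = 1 by omega,
    show (2 * n + 1) / 2 = n by omega]
  simp

/-- Let `F` be the power series over `ℤ` with `n`-th coefficient
`2^(e₀ n)`, and `F₂` the power series with `n`-th coefficient `2^(e₀ (n/2))` if
`n` is even and `0` otherwise (so `F₂` represents `F(X²)`). Then
`(X + 2)·F₂ = 1 + F`. -/
theorem stmt_17 :
    ((PowerSeries.X : PowerSeries ℤ) + 2) *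
        PowerSeries.mk (fun n => if Even n then (2 : ℤ) ^ binaryZeros (n / 2) else 0)
    = 1 + PowerSeries.mk (fun n => (2 : ℤ) ^ binaryZeros n) := by
  ext n
  rw [add_mul, two_mul]
  cases n with
  | zero => simp [binaryZeros]
  | succ k =>
    simp only [map_add, PowerSeries.coeff_succ_X_mul, PowerSeries.coeff_mk,
      PowerSeries.coeff_one, Nat.succ_ne_zero, if_false, zero_add]
    rcases Nat.even_or_odd' k with ⟨m, rfl | rfl⟩
    · simp [binaryZeros_two_mul_add_one]
    · rw [show 2 * m + 1 + 1 = 2 * (m + 1) by ring, binaryZeros_two_mul m.succ_ne_zero]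
      simp [pow_succ, mul_two]
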